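/- arXiv:2010.15418 — 3 statements merged into one kernel-verified Lean document; each statement's English description precedes it below -/
import Mathlib

section
/- For every positive integer n and every function σ from the edges of the complete graph K_{4n} to {-1,1} with total sum σ(E(K_{4n})) = 0, there exists a perfect matching M in K_{4n} with σ(M) = 0. -/
open Finset

noncomputable def sumE {m : ℕ} (σ : Sym2 (Fin m) → ℤ) (S : Set (Sym2 (Fin m))) : ℤ :=
  ∑ e ∈ S.toFinite.toFinset, σ e

def Kc (m : ℕ) : SimpleGraph (Fin m) := ⊤

namespace ZS

variable {V : Type*} [Fintype V] [DecidableEq V]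

def Valid (m : Multiset (V × V)) : Prop :=
  m.map Prod.fst + m.map Prod.snd = (Finset.univ : Finset V).val

def val (s : V → V → ℤ) (m : Multiset (V × V)) : ℤ := (m.map fun e => s e.1 e.2).sum

def BB (s : V → V → ℤ) (e f : V × V) : ℤ := s e.1 f.1 + s e.1 f.2 + s e.2 f.1 + s e.2 f.2

def SS (s : V → V → ℤ) (A B : Multiset V) : ℤ := (A.map fun u => (B.map fun v => s u v).sum).sum

def DD (s : V → V → ℤ) (m : Multiset (V × V)) : ℤ :=
  SS s (m.map Prod.fst + m.map Prod.snd) (m.map Prod.fst + m.map Prod.snd)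


theorem DD_cons (s : V → V → ℤ) (hsym : ∀ u v, s u v = s v u) (hd : ∀ u, s u u = 0)
    (e : V × V) (m : Multiset (V × V)) :
    DD s (e ::ₘ m) = DD s m + 2 * s e.1 e.2 + 2 * (m.map (BB s e)).sum := by
  have h1 : ∀ a, (m.map fun f => s f.1 a).sum = (m.map fun f => s a f.1).sum := by
    intro a; congr 1; apply Multiset.map_congr rfl; intros; apply hsym
  have h2 : ∀ a, (m.map fun f => s f.2 a).sum = (m.map fun f => s a f.2).sum := by
    intro a; congr 1; apply Multiset.map_congr rfl; intros; apply hsym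
  have h3 : (m.map (BB s e)).sum = (m.map fun f => s e.1 f.1).sum + (m.map fun f => s e.1 f.2).sum
      + (m.map fun f => s e.2 f.1).sum + (m.map fun f => s e.2 f.2).sum := by
    simp only [← Multiset.sum_map_add]; rfl
  rw [h3]
  simp only [DD, SS, Multiset.map_cons, Multiset.map_add, Multiset.sum_add, Multiset.sum_cons,
    Multiset.map_map, Function.comp_def, Multiset.sum_map_add, hd, h1, h2, hsym e.2 e.1]
  ring


theorem dvd_DD (s : V → V → ℤ) (hsym : ∀ u v, s u v = s v u) (hd : ∀ u, s u u = 0)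
    (m : Multiset (V × V)) (h : ∀ e f R, m = e ::ₘ f ::ₘ R → 4 ∣ BB s e f) :
    8 ∣ DD s m - 2 * val s m := by
  induction m using Multiset.induction_on with
  | empty => simp [DD, SS, val]
  | cons e m ih =>
    have h1 := ih (by
      intro a b R hR
      apply h a b (e ::ₘ R)
      rw [hR, Multiset.cons_swap e a, Multiset.cons_swap e b])
    have h2 : (4:ℤ) ∣ (m.map (BB s e)).sum := by
      apply Multiset.dvd_sum
      intro x hx
      obtain ⟨f, hf, rfl⟩ := Multiset.mem_map.1 hx
      obtain ⟨R, hR⟩ := Multiset.exists_cons_of_mem hf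
      exact h e f R (by rw [hR])
    rw [DD_cons s hsym hd]
    have : val s (e ::ₘ m) = s e.1 e.2 + val s m := by simp [val]
    rw [this]
    omega

theorem DD_valid (s : V → V → ℤ) (h0 : ∑ u, ∑ v, s u v = 0) (m : Multiset (V × V))
    (hm : Valid m) : DD s m = 0 := by
  unfold Valid at hm
  unfold DD SS
  rw [hm]; exact h0

theorem exists_odd (s : V → V → ℤ) (hsym : ∀ u v, s u v = s v u) (hd : ∀ u, s u u = 0)
    (h0 : ∑ u, ∑ v, s u v = 0) (e f : V × V) (R : Multiset (V × V))
    (hm : Valid (e ::ₘ f ::ₘ R)) (hv : val s (e ::ₘ f ::ₘ R) = 2 ∨ val s (e ::ₘ f ::ₘ R) = -2) :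
    (∃ g h R', R = g ::ₘ h ::ₘ R' ∧ ¬ 4 ∣ BB s g h) ∨ ¬ 4 ∣ BB s e f ∨
    ∃ g R', R = g ::ₘ R' ∧ (¬ 4 ∣ BB s e g ∨ ¬ 4 ∣ BB s f g) := by
  by_contra hcon
  push Not at hcon
  obtain ⟨c1, c2, c3⟩ := hcon
  have h1 := dvd_DD s hsym hd R c1
  have h2 := DD_valid s h0 _ hm
  rw [DD_cons s hsym hd, DD_cons s hsym hd] at h2
  have h3 : (4:ℤ) ∣ (R.map (BB s e)).sum := by
    apply Multiset.dvd_sum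
    intro x hx
    obtain ⟨f, hf, rfl⟩ := Multiset.mem_map.1 hx
    obtain ⟨R, hR⟩ := Multiset.exists_cons_of_mem hf
    exact (c3 _ _ hR).1
  have h4 : (4:ℤ) ∣ (R.map (BB s f)).sum := by
    apply Multiset.dvd_sum
    intro x hx
    obtain ⟨f, hf, rfl⟩ := Multiset.mem_map.1 hx
    obtain ⟨R, hR⟩ := Multiset.exists_cons_of_mem hf
    exact (c3 _ _ hR).2
  have h5 : val s (e ::ₘ f ::ₘ R) = s e.1 e.2 + s f.1 f.2 + val s R := by simp [val]; ring
  rw [h5] at hv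
  simp only [Multiset.map_cons, Multiset.sum_cons] at h2
  omega

theorem K6 {ε ab cd ac bd ad bc az aw bz bw cz cw zw : ℤ} (hε : ε = 1 ∨ ε = -1)
    (_ : ab = ε) (_ : cd = ε) (_ : ad = ε) (_ : bc = ε) (_ : ac = -ε) (_ : bd = -ε)
    (_ : az = 1 ∨ az = -1) (_ : aw = 1 ∨ aw = -1) (_ : bz = 1 ∨ bz = -1) (_ : bw = 1 ∨ bw = -1)
    (_ : cz = 1 ∨ cz = -1) (_ : cw = 1 ∨ cw = -1) (_ : zw = 1 ∨ zw = -1)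
    (_ : az + bw + cd ≠ zw) (_ : bw + cz + ad ≠ zw) (_ : aw + bz + cd ≠ zw)
    (_ : bz + cw + ad ≠ zw) (_ : az + cw + bd ≠ zw) (_ : aw + cz + bd ≠ zw) :
    4 ∣ az + aw + cz + cw := by
  subst_vars
  rcases hε with rfl | rfl <;> rcases ‹zw = 1 ∨ zw = -1› with rfl | rfl
  · have : az = bw := by omega
    have : bw = cz := by omega
    have : aw = bz := by omega
    have : bz = cw := by omega
    omega
  · have : az = cw := by omega
    have : aw = cz := by omega
    omega
  · have : az = cw := by omega
    have : aw = cz := by omega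
    omega
  · have : az = bw := by omega
    have : bw = cz := by omega
    have : aw = bz := by omega
    have : bz = cw := by omega
    omega

theorem valid4 {a b c d : V} {R : Multiset (V × V)} (h : Valid ((a, b) ::ₘ (c, d) ::ₘ R)) :
    a ≠ b ∧ a ≠ c ∧ a ≠ d ∧ b ≠ c ∧ b ≠ d ∧ c ≠ d := by
  have h1 : (R.map Prod.fst + R.map Prod.snd + (a ::ₘ b ::ₘ c ::ₘ {d})).Nodup := by
    have h2 := (Finset.univ : Finset V).nodup
    rw [← h] at h2
    convert h2 using 1
    simp only [Multiset.map_cons]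
    simp only [← Multiset.singleton_add]
    abel
  have h3 := (Multiset.nodup_add.1 h1).2.1
  simp at h3
  tauto

/-- switching an adjacent pair -/
theorem local_contra (s : V → V → ℤ) (hsym : ∀ u v, s u v = s v u) (hd : ∀ u, s u u = 0)
    (hpm : ∀ u v, u ≠ v → s u v = 1 ∨ s u v = -1)
    (h0 : ∑ u, ∑ v, s u v = 0) (H : ∀ m, Valid m → val s m ≠ 0)
    (a b c d : V) (R : Multiset (V × V)) (hm : Valid ((a, b) ::ₘ (c, d) ::ₘ R))
    (h1 : s a b + s c d + val s R = 2) (h2 : s a c + s b d + val s R = -2) : False := by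
  obtain ⟨n1, n2, n3, n4, n5, n6⟩ := valid4 hm
  have vc : ∀ (u v : V) (R : Multiset (V × V)), val s ((u, v) ::ₘ R) = s u v + val s R := by
    intros; simp [val]
  have e1 := hpm _ _ n1
  have e2 := hpm _ _ n2
  have e3 := hpm _ _ n3
  have e4 := hpm _ _ n4
  have e5 := hpm _ _ n5
  have e6 := hpm _ _ n6
  have hm' : Valid ((a, c) ::ₘ (b, d) ::ₘ R) := by
    unfold Valid at hm ⊢
    rw [← hm]
    simp only [Multiset.map_cons]
    simp only [← Multiset.singleton_add]
    abel
  have hm'' : Valid ((a, d) ::ₘ (b, c) ::ₘ R) := by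
    unfold Valid at hm ⊢
    rw [← hm]
    simp only [Multiset.map_cons]
    simp only [← Multiset.singleton_add]
    abel
  have h3 := H _ hm''
  simp only [vc] at h3
  have hr : val s R = 0 := by omega
  have hab : s a b = 1 := by omega
  have hcd : s c d = 1 := by omega
  have hac : s a c = -1 := by omega
  have hbd : s b d = -1 := by omega
  have had : s a d = s b c := by omega
  -- odd pair inside R
  have case1 : ∀ g h R', R = g ::ₘ h ::ₘ R' → 4 ∣ BB s g h := by
    rintro ⟨x, y⟩ ⟨z, w⟩ R' rfl
    have hv0 : Valid ((x, y) ::ₘ (z, w) ::ₘ (a, b) ::ₘ (c, d) ::ₘ R') := by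
      unfold Valid at hm ⊢
      rw [← hm]
      simp only [Multiset.map_cons]
      simp only [← Multiset.singleton_add]
      abel
    obtain ⟨k1, k2, k3, k4, k5, k6⟩ := valid4 hv0
    have f1 := hpm _ _ k1
    have f2 := hpm _ _ k2
    have f3 := hpm _ _ k3
    have f4 := hpm _ _ k4
    have f5 := hpm _ _ k5
    have f6 := hpm _ _ k6
    have F : ∀ p q r t : V, ({p, q, r, t} : Multiset V) = {x, y, z, w} →
        s p q + s r t + val s R' ≠ 2 ∧ s p q + s r t + val s R' ≠ -2 := by
      intro p q r t hp
      simp only [Multiset.insert_eq_cons, ← Multiset.singleton_add] at hp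
      have A1 : Valid ((p, q) ::ₘ (r, t) ::ₘ (a, b) ::ₘ (c, d) ::ₘ R') := by
        unfold Valid at hv0 ⊢
        rw [← hv0]
        simp only [Multiset.map_cons]
        simp only [← Multiset.singleton_add]
        calc _ = (({p} : Multiset V) + ({q} + ({r} + {t}))) + ({a} + {b} + {c} + {d} +
              R'.map Prod.fst + R'.map Prod.snd) := by abel
          _ = _ := by rw [hp]; abel
      have A2 : Valid ((p, q) ::ₘ (r, t) ::ₘ (a, c) ::ₘ (b, d) ::ₘ R') := by
        unfold Valid at A1 ⊢
        rw [← A1]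
        simp only [Multiset.map_cons]
        simp only [← Multiset.singleton_add]
        abel
      have B1 := H _ A1
      have B2 := H _ A2
      simp only [vc] at B1 B2
      omega
    have F1 := F x z y w (by
      simp only [Multiset.insert_eq_cons, ← Multiset.singleton_add]; abel)
    have F2 := F x w y z (by
      simp only [Multiset.insert_eq_cons, ← Multiset.singleton_add]; abel)
    simp only [vc] at hr
    simp only [BB]
    omega
  -- K6
  have F : ∀ z w R', R = (z, w) ::ₘ R' → ∀ p q r t u v : V,
      ({p, q, r, t, u, v} : Multiset V) = {a, b, c, d, z, w} →
        s p q + s r t + s u v ≠ s z w := by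
    rintro z w R' rfl p q r t u v hp
    simp only [Multiset.insert_eq_cons, ← Multiset.singleton_add] at hp
    have A1 : Valid ((p, q) ::ₘ (r, t) ::ₘ (u, v) ::ₘ R') := by
      unfold Valid at hm ⊢
      rw [← hm]
      simp only [Multiset.map_cons]
      simp only [← Multiset.singleton_add]
      calc _ = (({p} : Multiset V) + ({q} + ({r} + ({t} + ({u} + {v}))))) + (
            R'.map Prod.fst + R'.map Prod.snd) := by abel
        _ = _ := by rw [hp]; abel
    have B1 := H _ A1
    simp only [vc] at B1 hr
    omega
  have G : ∀ z w R', R = (z, w) ::ₘ R' → 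
      (s z w = 1 ∨ s z w = -1) ∧ (s a z = 1 ∨ s a z = -1) ∧ (s a w = 1 ∨ s a w = -1) ∧
      (s b z = 1 ∨ s b z = -1) ∧ (s b w = 1 ∨ s b w = -1) ∧
      (s c z = 1 ∨ s c z = -1) ∧ (s c w = 1 ∨ s c w = -1) ∧
      (s d z = 1 ∨ s d z = -1) ∧ (s d w = 1 ∨ s d w = -1) := by
    rintro z w R' rfl
    have A1 : Valid ((a, b) ::ₘ (z, w) ::ₘ (c, d) ::ₘ R') := by
      rw [Multiset.cons_swap (z, w)]; exact hm
    have A2 : Valid ((c, d) ::ₘ (z, w) ::ₘ (a, b) ::ₘ R') := by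
      rw [Multiset.cons_swap (z, w), Multiset.cons_swap (c, d)]; exact hm
    obtain ⟨k1, k2, k3, k4, k5, k6⟩ := valid4 A1
    obtain ⟨l1, l2, l3, l4, l5, l6⟩ := valid4 A2
    exact ⟨hpm _ _ k6, hpm _ _ k2, hpm _ _ k3, hpm _ _ k4, hpm _ _ k5, hpm _ _ l2, hpm _ _ l3,
      hpm _ _ l4, hpm _ _ l5⟩
  have sba := hsym b a
  have sca := hsym c a
  have sda := hsym d a
  have scb := hsym c b
  have sdb := hsym d b
  have sdc := hsym d c
  rcases e3 with e3 | e3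
  · rcases exists_odd s hsym hd h0 _ _ _ hm' (Or.inr (by simp only [vc]; omega)) with
      ⟨g, h, R', hR, hn⟩ | hn | ⟨⟨z, w⟩, R', hR, hn⟩
    · exact hn (case1 _ _ _ hR)
    · simp only [BB] at hn; omega
    · obtain ⟨g0, g1, g2, g3, g4, g5, g6, g7, g8⟩ := G _ _ _ hR
      have F' := F _ _ _ hR
      simp only [Multiset.insert_eq_cons, ← Multiset.singleton_add] at F'
      rcases hn with hn | hn
      · apply hn
        exact K6 (ε := 1) (ab := s a b) (cd := s c d) (ad := s a d) (bc := s b c) (ac := s a c)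
          (bd := s b d) (Or.inl rfl) hab hcd e3 (by omega) hac hbd g1 g2 g3 g4 g5 g6 g0
          (F' a z b w c d (by abel)) (F' b w c z a d (by abel)) (F' a w b z c d (by abel))
          (F' b z c w a d (by abel)) (F' a z c w b d (by abel)) (F' a w c z b d (by abel))
      · apply hn
        exact K6 (ε := 1) (ab := s b a) (cd := s d c) (ad := s b c) (bc := s a d) (ac := s b d)
          (bd := s a c) (Or.inl rfl) (by omega) (by omega) (by omega) (by omega) hbd hac
          g3 g4 g1 g2 g7 g8 g0
          (F' b z a w d c (by abel)) (F' a w d z b c (by abel)) (F' b w a z d c (by abel))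
          (F' a z d w b c (by abel)) (F' b z d w a c (by abel)) (F' b w d z a c (by abel))
  · rcases exists_odd s hsym hd h0 _ _ _ hm (Or.inl (by simp only [vc]; omega)) with
      ⟨g, h, R', hR, hn⟩ | hn | ⟨⟨z, w⟩, R', hR, hn⟩
    · exact hn (case1 _ _ _ hR)
    · simp only [BB] at hn; omega
    · obtain ⟨g0, g1, g2, g3, g4, g5, g6, g7, g8⟩ := G _ _ _ hR
      have F' := F _ _ _ hR
      simp only [Multiset.insert_eq_cons, ← Multiset.singleton_add] at F'
      rcases hn with hn | hn
      · apply hn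
        exact K6 (ε := -1) (ab := s a c) (cd := s b d) (ad := s a d) (bc := s c b) (ac := s a b)
          (bd := s c d) (Or.inr rfl) hac hbd e3 (by omega) (by omega) (by omega)
          g1 g2 g5 g6 g3 g4 g0
          (F' a z c w b d (by abel)) (F' c w b z a d (by abel)) (F' a w c z b d (by abel))
          (F' c z b w a d (by abel)) (F' a z b w c d (by abel)) (F' a w b z c d (by abel))
      · apply hn
        exact K6 (ε := -1) (ab := s c a) (cd := s d b) (ad := s c b) (bc := s a d) (ac := s c d)
          (bd := s a b) (Or.inr rfl) (by omega) (by omega) (by omega) (by omega) (by omega)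
          (by omega) g5 g6 g1 g2 g7 g8 g0
          (F' c z a w d b (by abel)) (F' a w d z c b (by abel)) (F' c w a z d b (by abel))
          (F' a z d w c b (by abel)) (F' c z d w a b (by abel)) (F' c w d z a b (by abel))

variable {ι : Type*} [Fintype ι] [DecidableEq ι]

def mp (p : ι × Bool ≃ V) : Multiset (V × V) :=
  (Finset.univ : Finset ι).val.map fun i => (p (i, false), p (i, true))

theorem mp_valid (p : ι × Bool ≃ V) : Valid (mp p) := by
  unfold Valid mp
  rw [Multiset.map_map, Multiset.map_map]
  refine (Multiset.Nodup.ext ?_ (Finset.univ : Finset V).nodup).2 ?_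
  · rw [Multiset.nodup_add]
    refine ⟨Multiset.Nodup.map ?_ (Finset.nodup _), Multiset.Nodup.map ?_ (Finset.nodup _), ?_⟩
    · intro i j h; simpa using h
    · intro i j h; simpa using h
    · rw [Multiset.disjoint_left]
      intro v h1 h2
      obtain ⟨i, -, hi⟩ := Multiset.mem_map.1 h1
      obtain ⟨j, -, hj⟩ := Multiset.mem_map.1 h2
      rw [← hj] at hi
      simp at hi
  · intro v
    simp only [Finset.mem_val, Finset.mem_univ, iff_true, Multiset.mem_add, Multiset.mem_map,
      true_and, Function.comp]
    obtain ⟨⟨i, b⟩, rfl⟩ := p.surjective v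
    cases b
    · left; exact ⟨i, rfl⟩
    · right; exact ⟨i, rfl⟩

theorem step (s : V → V → ℤ) (hsym : ∀ u v, s u v = s v u) (p : ι × Bool ≃ V) (x y : ι × Bool) :
    val s (mp ((Equiv.swap x y).trans p)) = val s (mp p) ∨
    ∃ A B C D R, Valid ((A, B) ::ₘ (C, D) ::ₘ R) ∧ val s (mp p) = s A B + s C D + val s R ∧
      val s (mp ((Equiv.swap x y).trans p)) = s A C + s B D + val s R := by
  obtain ⟨i, b⟩ := x
  obtain ⟨j, c⟩ := y
  by_cases hij : i = j
  · subst hij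
    left
    unfold val mp
    rw [Multiset.map_map, Multiset.map_map]
    congr 1
    apply Multiset.map_congr rfl
    intro k _
    by_cases hk : k = i
    · subst hk
      cases b <;> cases c <;> simp [hsym (p (k, true))]
    · simp only [Function.comp, Equiv.trans_apply]
      rw [Equiv.swap_apply_of_ne_of_ne, Equiv.swap_apply_of_ne_of_ne] <;> simp [hk]
  · right
    let R : Multiset (V × V) := ((Finset.univ.erase i).erase j).val.map
      fun k => (p (k, false), p (k, true))
    have hu : (Finset.univ : Finset ι).val = i ::ₘ j ::ₘ ((Finset.univ.erase i).erase j).val := by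
      have h1 : j ∈ Finset.univ.erase i := by simp [Ne.symm hij]
      rw [Finset.erase_val _ j, Multiset.cons_erase h1, Finset.erase_val,
        Multiset.cons_erase (Finset.mem_univ i)]
    have e1 : mp p = (p (i, false), p (i, true)) ::ₘ (p (j, false), p (j, true)) ::ₘ R := by
      unfold mp; rw [hu]; simp [R]
    have e2 : mp ((Equiv.swap (i, b) (j, c)).trans p) =
        (p (Equiv.swap (i, b) (j, c) (i, false)), p (Equiv.swap (i, b) (j, c) (i, true))) ::ₘ
        (p (Equiv.swap (i, b) (j, c) (j, false)), p (Equiv.swap (i, b) (j, c) (j, true))) ::ₘ R := by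
      unfold mp; rw [hu]; simp only [Multiset.map_cons, Equiv.trans_apply, R]
      congr 2
      apply Multiset.map_congr rfl
      intro k hk
      have hk' : k ≠ j ∧ k ≠ i := by
        have := Finset.mem_def.2 hk
        simpa using this
      rw [Equiv.swap_apply_of_ne_of_ne, Equiv.swap_apply_of_ne_of_ne] <;> simp [hk']
    have hv := mp_valid p
    rw [e1] at hv
    have vc : ∀ (u v : V) (R : Multiset (V × V)), val s ((u, v) ::ₘ R) = s u v + val s R := by
      intros; simp [val]
    have hji : ¬ j = i := fun h => hij h.symm
    have t1 : ∀ b', b' ≠ b → Equiv.swap (i, b) (j, c) (i, b') = (i, b') := by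
      intro b' h
      apply Equiv.swap_apply_of_ne_of_ne <;> simp [h, hij]
    have t2 : ∀ c', c' ≠ c → Equiv.swap (i, b) (j, c) (j, c') = (j, c') := by
      intro c' h
      apply Equiv.swap_apply_of_ne_of_ne <;> simp [h, hji]
    refine ⟨p (i, !b), p (i, b), p (j, c), p (j, !c), R, ?_, ?_, ?_⟩
    · unfold Valid at hv ⊢
      rw [← hv]
      simp only [Multiset.map_cons]
      simp only [← Multiset.singleton_add]
      cases b <;> cases c <;> simp only [Bool.not_true, Bool.not_false] <;> abel
    · rw [e1, vc, vc]
      cases b <;> cases c <;> simp only [Bool.not_true, Bool.not_false] <;>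
        (try simp only [hsym (p (i, true)) (p (i, false)), hsym (p (j, true)) (p (j, false))]) <;> ring
    · rw [e2, vc, vc]
      have t1' := t1 (!b) (by simp)
      have t2' := t2 (!c) (by simp)
      have t3 := Equiv.swap_apply_left (i, b) (j, c)
      have t4 := Equiv.swap_apply_right (i, b) (j, c)
      cases b <;> cases c <;> simp only [Bool.not_true, Bool.not_false] at * <;>
        rw [t1', t2', t3, t4]
      · rw [hsym (p (j, false)) (p (i, true))]; ring
      · rw [hsym (p (j, true)) (p (i, true)), hsym (p (j, false)) (p (i, false))]; ring
      · ring
      · rw [hsym (p (j, false)) (p (i, true))]; ring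

theorem avg {P : Type*} [Fintype P] [DecidableEq P] (g : P → P → ℤ) (hd : ∀ u, g u u = 0)
    (h0 : ∑ u, ∑ v, g u v = 0) (x y : P) (hxy : x ≠ y) :
    ∑ π : Equiv.Perm P, g (π x) (π y) = 0 := by
  have key : ∀ x' y', x' ≠ y' → ∑ π : Equiv.Perm P, g (π x') (π y') =
      ∑ π : Equiv.Perm P, g (π x) (π y) := by
    intro x' y' h
    let ρ : Equiv.Perm P := Equiv.swap (Equiv.swap x x' y) y' * Equiv.swap x x'
    have hx : ρ x = x' := by
      simp only [ρ, Equiv.Perm.mul_apply, Equiv.swap_apply_left]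
      apply Equiv.swap_apply_of_ne_of_ne _ h
      intro hh
      apply hxy
      apply (Equiv.swap x x').injective
      rw [Equiv.swap_apply_left]; exact hh
    have hy : ρ y = y' := by
      simp [ρ, Equiv.Perm.mul_apply]
    rw [← Equiv.sum_comp (Equiv.mulRight ρ) (fun π : Equiv.Perm P => g (π x) (π y))]
    apply Finset.sum_congr rfl
    intro π _
    simp [Equiv.Perm.mul_apply, hx, hy]
  have h1 : ∑ x', ∑ y', ∑ π : Equiv.Perm P, g (π x') (π y') = 0 := by
    have : ∀ π : Equiv.Perm P, ∑ x', ∑ y', g (π x') (π y') = 0 := by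
      intro π
      rw [← h0, ← Equiv.sum_comp π (fun u => ∑ v, g u v)]
      apply Finset.sum_congr rfl
      intro u _
      exact Equiv.sum_comp π (fun v => g (π u) v)
    calc _ = ∑ x', ∑ π : Equiv.Perm P, ∑ y', g (π x') (π y') := by
            apply Finset.sum_congr rfl; intro _ _; rw [Finset.sum_comm]
      _ = ∑ π : Equiv.Perm P, ∑ x', ∑ y', g (π x') (π y') := by rw [Finset.sum_comm]
      _ = 0 := by simp [this]
  have h2 : ∑ x', ∑ y', ∑ π : Equiv.Perm P, g (π x') (π y') =
      ∑ x' : P, ∑ y' : P, (if x' = y' then 0 else ∑ π : Equiv.Perm P, g (π x) (π y)) := by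
    apply Finset.sum_congr rfl; intro x' _
    apply Finset.sum_congr rfl; intro y' _
    split_ifs with h
    · subst h; simp [hd]
    · exact key _ _ h
  rw [h2] at h1
  by_contra hne
  rw [← Finset.sum_product' (f := fun x' y' : P =>
    (if x' = y' then 0 else ∑ π : Equiv.Perm P, g (π x) (π y)))] at h1
  rw [Finset.sum_ite, Finset.sum_const_zero, zero_add, Finset.sum_const, nsmul_eq_mul] at h1
  rcases mul_eq_zero.1 h1 with h | h
  · have h' : ((univ ×ˢ univ : Finset (P × P)).filter fun q => ¬ q.1 = q.2).card = 0 := by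
      exact_mod_cast h
    rw [Finset.card_eq_zero] at h'
    have : (x, y) ∈ ((univ ×ˢ univ : Finset (P × P)).filter fun q => ¬ q.1 = q.2) := by
      simp [hxy]
    rw [h'] at this
    simp at this
  · exact hne h

theorem main (s : V → V → ℤ) (hsym : ∀ u v, s u v = s v u) (hd : ∀ u, s u u = 0)
    (hpm : ∀ u v, u ≠ v → s u v = 1 ∨ s u v = -1)
    (h0 : ∑ u, ∑ v, s u v = 0) (e0 : ι × Bool ≃ V) (hc : Even (Fintype.card ι)) :
    ∃ m, Valid m ∧ val s m = 0 := by
  by_contra hcon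
  have H : ∀ m, Valid m → val s m ≠ 0 := by
    intro m hm h; exact hcon ⟨m, hm, h⟩
  have hval : ∀ p : ι × Bool ≃ V, val s (mp p) = ∑ i, s (p (i, false)) (p (i, true)) := by
    intro p; unfold val mp; rw [Multiset.map_map]; rfl
  have hev : ∀ p : ι × Bool ≃ V, Even (val s (mp p)) := by
    intro p
    rw [hval]
    have : (∑ i, s (p (i, false)) (p (i, true))) =
        ∑ i, (s (p (i, false)) (p (i, true)) - 1) + (Fintype.card ι : ℤ) := by
      simp
    rw [this]
    apply Even.add
    · apply Finset.even_sum
      intro i _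
      have : p (i, false) ≠ p (i, true) := by simp
      rcases hpm _ _ this with h | h <;> rw [h] <;> decide
    · exact_mod_cast hc
  have hsum : ∑ π : Equiv.Perm (ι × Bool), val s (mp (π.trans e0)) = 0 := by
    simp only [hval, Equiv.trans_apply]
    rw [Finset.sum_comm]
    apply Finset.sum_eq_zero
    intro i _
    apply avg (fun u v => s (e0 u) (e0 v)) (fun u => hd _) _ _ _ (by simp)
    rw [← h0, ← Equiv.sum_comp e0]
    apply Finset.sum_congr rfl
    intro u _
    rw [← Equiv.sum_comp e0]
  have hstep : ∀ p : ι × Bool ≃ V, ∀ x y, 0 < val s (mp p) →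
      0 < val s (mp ((Equiv.swap x y).trans p)) := by
    intro p x y hp
    have hn := H _ (mp_valid ((Equiv.swap x y).trans p))
    have ev1 := hev p
    have ev2 := hev ((Equiv.swap x y).trans p)
    rcases step s hsym p x y with h | ⟨A, B, C, D, R, hv, h1, h2⟩
    · rw [h]; exact hp
    · by_contra hneg
      obtain ⟨n1, n2, n3, n4, n5, n6⟩ := valid4 hv
      have e1 := hpm _ _ n1
      have e2 := hpm _ _ n2
      have e5 := hpm _ _ n5
      have e6 := hpm _ _ n6
      obtain ⟨k1, hk1⟩ := ev1
      obtain ⟨k2, hk2⟩ := ev2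
      exact local_contra s hsym hd hpm h0 H A B C D R hv (by omega) (by omega)
  have hall : ∀ p : ι × Bool ≃ V, 0 < val s (mp p) → ∀ π : Equiv.Perm (ι × Bool),
      0 < val s (mp (π.trans p)) := by
    intro p hp π
    induction π using Equiv.Perm.swap_induction_on' with
    | one => exact hp
    | mul_swap f x y _ ih => exact hstep _ x y ih
  have hne : (Finset.univ : Finset (Equiv.Perm (ι × Bool))).Nonempty := ⟨1, Finset.mem_univ _⟩
  by_cases hpos : ∃ π : Equiv.Perm (ι × Bool), 0 < val s (mp (π.trans e0))
  · obtain ⟨π, hπ⟩ := hpos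
    have : 0 < ∑ π : Equiv.Perm (ι × Bool), val s (mp (π.trans e0)) := by
      apply Finset.sum_pos _ hne
      intro τ _
      have := hall _ hπ (π⁻¹ * τ)
      have e : (π⁻¹ * τ).trans (π.trans e0) = τ.trans e0 := by
        ext x; simp
      rwa [e] at this
    omega
  · push Not at hpos
    have : ∑ π : Equiv.Perm (ι × Bool), val s (mp (π.trans e0)) < 0 := by
      apply Finset.sum_neg _ hne
      intro τ _
      exact lt_of_le_of_ne (hpos τ) (H _ (mp_valid _))
    omega

end ZS

theorem stmt0 (n : ℕ) (hn : 0 < n) (σ : Sym2 (Fin (4*n)) → ℤ)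
    (hσ : ∀ e ∈ (Kc (4*n)).edgeSet, σ e = 1 ∨ σ e = -1)
    (hsum : sumE σ (Kc (4*n)).edgeSet = 0) :
    ∃ M : (Kc (4*n)).Subgraph, M.IsPerfectMatching ∧ sumE σ M.edgeSet = 0 := by
  classical
  let s : Fin (4*n) → Fin (4*n) → ℤ := fun u v => if u = v then 0 else σ s(u, v)
  have h0 : ∑ u, ∑ v, s u v = 0 := by
    have e1 : (Kc (4*n)).edgeSet.toFinite.toFinset = (⊤ : SimpleGraph (Fin (4*n))).edgeFinset := by
      ext e; simp [Kc]
    unfold sumE at hsum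
    rw [e1] at hsum
    have e2 : ∑ d : (⊤ : SimpleGraph (Fin (4*n))).Dart, σ d.edge =
        ∑ e ∈ (⊤ : SimpleGraph (Fin (4*n))).edgeFinset, 2 * σ e := by
      rw [← Finset.sum_fiberwise_of_maps_to (s := Finset.univ)
        (t := (⊤ : SimpleGraph (Fin (4*n))).edgeFinset) (g := fun d => d.edge)
        (by intro d _; rw [SimpleGraph.mem_edgeFinset]; exact d.edge_mem)]
      apply Finset.sum_congr rfl
      intro e he
      rw [Finset.sum_congr rfl (g := fun _ => σ e) (by
        intro d hd; rw [(Finset.mem_filter.1 hd).2])]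
      rw [Finset.sum_const, SimpleGraph.dart_edge_fiber_card _ e (by simpa using he)]
      simp
    rw [← Finset.mul_sum, hsum] at e2
    rw [← Finset.sum_product']
    have e3 : ∑ q ∈ (univ ×ˢ univ : Finset (Fin (4*n) × Fin (4*n))), s q.1 q.2 =
        ∑ q ∈ (univ ×ˢ univ : Finset (Fin (4*n) × Fin (4*n))).filter (fun q => q.1 ≠ q.2),
          σ s(q.1, q.2) := by
      rw [Finset.sum_filter]
      apply Finset.sum_congr rfl
      intro q _
      simp only [s]
      by_cases h : q.1 = q.2 <;> simp [h]
    rw [e3]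
    rw [mul_zero] at e2
    rw [← e2]
    symm
    refine Finset.sum_bij (fun d _ => d.toProd) ?_ ?_ ?_ ?_
    · intro d _; simpa using d.adj
    · intro d _ d' _ h; exact SimpleGraph.Dart.ext _ _ h
    · intro q hq
      exact ⟨⟨q, by simpa using hq⟩, Finset.mem_univ _, rfl⟩
    · intro d _; rfl
  obtain ⟨m, hm, hv⟩ := ZS.main (ι := Fin (2*n)) s
    (by intro u v; simp only [s, Sym2.eq_swap (a := u), eq_comm (a := u)])
    (by intro u; simp [s])
    (by intro u v h; simp only [s, h, if_false]; apply hσ; simpa [Kc] using h)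
    h0 (Fintype.equivOfCardEq (by simp; ring)) (by simp)
  unfold ZS.Valid at hm
  have hnd : (m.map Prod.fst + m.map Prod.snd).Nodup := by rw [hm]; exact Finset.nodup _
  obtain ⟨nd1, nd2, nd3⟩ := Multiset.nodup_add.1 hnd
  rw [Multiset.disjoint_left] at nd3
  have i1 : ∀ e ∈ m, ∀ f ∈ m, e.1 = f.1 → e = f := fun e he f hf h =>
    Multiset.inj_on_of_nodup_map nd1 e he f hf h
  have i2 : ∀ e ∈ m, ∀ f ∈ m, e.2 = f.2 → e = f := fun e he f hf h =>
    Multiset.inj_on_of_nodup_map nd2 e he f hf h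
  have i3 : ∀ e ∈ m, ∀ f ∈ m, e.1 ≠ f.2 := fun e he f hf h =>
    nd3 (Multiset.mem_map_of_mem _ he) (h ▸ Multiset.mem_map_of_mem _ hf)
  have cov : ∀ v, (∃ w, (v, w) ∈ m) ∨ (∃ w, (w, v) ∈ m) := by
    intro v
    have : v ∈ m.map Prod.fst + m.map Prod.snd := by rw [hm]; exact Finset.mem_univ v
    rcases Multiset.mem_add.1 this with h | h
    · obtain ⟨⟨a, b⟩, h1, rfl⟩ := Multiset.mem_map.1 h
      exact Or.inl ⟨b, h1⟩
    · obtain ⟨⟨a, b⟩, h1, rfl⟩ := Multiset.mem_map.1 h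
      exact Or.inr ⟨a, h1⟩
  let M : (Kc (4*n)).Subgraph :=
    { verts := Set.univ
      Adj := fun u v => (u, v) ∈ m ∨ (v, u) ∈ m
      adj_sub := by
        intro u v h
        have : u ≠ v := by
          rintro rfl
          rcases h with h | h <;> exact i3 _ h _ h rfl
        simpa [Kc] using this
      edge_vert := fun _ => Set.mem_univ _
      symm := ⟨fun u v h => h.symm⟩ }
  refine ⟨M, ⟨?_, fun v => Set.mem_univ v⟩, ?_⟩
  · intro v _
    rcases cov v with ⟨w, hw⟩ | ⟨w, hw⟩
    · refine ⟨w, Or.inl hw, ?_⟩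
      rintro y (hy | hy)
      · exact congrArg Prod.snd (i1 _ hy _ hw rfl)
      · exact absurd rfl (i3 _ hw _ hy)
    · refine ⟨w, Or.inr hw, ?_⟩
      rintro y (hy | hy)
      · exact absurd rfl (i3 _ hy _ hw)
      · exact congrArg Prod.fst (i2 _ hy _ hw rfl)
  · have hE : M.edgeSet.toFinite.toFinset.val = m.map (fun e => s(e.1, e.2)) := by
      refine (Multiset.Nodup.ext (Finset.nodup _) ?_).2 ?_
      · apply Multiset.Nodup.map_on _ (Multiset.Nodup.of_map _ nd1)
        intro e he f hf h
        rcases Sym2.eq_iff.1 h with h | h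
        · exact i1 e he f hf h.1
        · exact absurd h.1 (i3 e he f hf)
      · intro e
        rw [Finset.mem_val, Set.Finite.mem_toFinset]
        induction e using Sym2.ind with
        | _ u v =>
          rw [SimpleGraph.Subgraph.mem_edgeSet, Multiset.mem_map]
          constructor
          · rintro (h | h)
            · exact ⟨_, h, rfl⟩
            · exact ⟨_, h, Sym2.eq_swap⟩
          · rintro ⟨⟨a, b⟩, h, h2⟩
            rcases Sym2.eq_iff.1 h2 with ⟨rfl, rfl⟩ | ⟨rfl, rfl⟩
            · exact Or.inl h
            · exact Or.inr h
    unfold sumE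
    rw [Finset.sum_eq_multiset_sum, hE, Multiset.map_map, ← hv]
    unfold ZS.val
    congr 1
    apply Multiset.map_congr rfl
    intro e he
    simp [s, i3 e he e he]
end

section
/- For all positive integers n and k with k ≥ 2, and every function σ: E(K_{4n}) → {-1,1} with |σ(E(K_{4n}))| < n(n−1) + k(6n−1) + k², there is a perfect matching M in K_{4n} with |σ(M)| ≤ 2k − 2. -/
open Finset

section aux

open Classical in
theorem two_sumE {m : ℕ} (σ : Sym2 (Fin m) → ℤ) (H : SimpleGraph (Fin m)) :
    2 * sumE σ H.edgeSet = ∑ v, ∑ w, if H.Adj v w then σ s(v, w) else 0 := by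
  have h1 : sumE σ H.edgeSet = ∑ e ∈ H.edgeFinset, σ e := by
    unfold sumE
    apply Finset.sum_congr _ (fun _ _ => rfl)
    ext e; simp
  have h2 : ∑ d : H.Dart, σ d.edge = 2 * ∑ e ∈ H.edgeFinset, σ e := by
    rw [← Finset.sum_fiberwise_of_maps_to (s := univ) (t := H.edgeFinset) (g := fun d : H.Dart => d.edge)
      (by intro d _; simpa using d.edge_mem), Finset.mul_sum]
    apply Finset.sum_congr rfl
    intro e he
    rw [Finset.sum_congr rfl (g := fun _ => σ e) (by intro d hd; simp at hd; rw [hd])]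
    rw [Finset.sum_const, H.dart_edge_fiber_card e (by simpa using he)]
    simp
  rw [h1, ← h2, ← Finset.sum_product', ← Finset.sum_filter]
  refine Finset.sum_bij (fun d _ => d.toProd) ?_ ?_ ?_ ?_
  · intro d _; simpa using d.adj
  · intro d _ d' _ h; exact SimpleGraph.Dart.ext _ _ h
  · intro p hp
    simp at hp
    exact ⟨⟨p, hp⟩, by simp, rfl⟩
  · intro d _; rfl

variable {V : Type} [Fintype V] [DecidableEq V]

/-- partial matchings inside `W`, as involutions -/
def PMt (r : V → V → Prop) (W : Finset V) (f : V → V) : Prop :=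
  (∀ x, f (f x) = x) ∧ ∀ x, f x ≠ x → x ∈ W ∧ r x (f x)

def msup (f : V → V) : Finset V := univ.filter (fun x => f x ≠ x)

theorem mem_msup (f : V → V) (x : V) : x ∈ msup f ↔ f x ≠ x := by simp [msup]

theorem add_edge {r : V → V → Prop} (hr : ∀ x y, r x y → r y x) {W : Finset V} {f : V → V}
    (hf : PMt r W f) {a b : V} (ha : a ∈ W) (hb : b ∈ W) (hab : a ≠ b) (hrab : r a b)
    (fa : f a = a) (fb : f b = b) :
    ∃ g, PMt r W g ∧ (msup g).card = (msup f).card + 2 ∧ ∀ x, f x ≠ x → g x = f x := by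
  obtain ⟨h1, h2⟩ := hf
  have hba := hr _ _ hrab
  refine ⟨fun x => if x = a then b else if x = b then a else f x, ⟨?_, ?_⟩, ?_, ?_⟩
  · intro x
    have := h1 x
    grind
  · intro x
    have := h2 x
    grind
  · have : msup (fun x => if x = a then b else if x = b then a else f x)
      = insert a (insert b (msup f)) := by
      ext x; simp only [mem_insert, mem_msup]; grind
    rw [this, card_insert_of_notMem, card_insert_of_notMem]
    · simp [mem_msup, fb]
    · simp [mem_msup, fa, hab]
  · intro x hx
    grind

theorem augment {r : V → V → Prop} (hr : ∀ x y, r x y → r y x) {W : Finset V} {f : V → V}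
    (hf : PMt r W f) {a b u : V} (ha : a ∈ W) (hb : b ∈ W) (hab : a ≠ b)
    (fa : f a = a) (fb : f b = b) (hu : f u ≠ u) (h1 : r u a) (h2 : r (f u) b) :
    ∃ g, PMt r W g ∧ (msup g).card = (msup f).card + 2 := by
  obtain ⟨hi, hm⟩ := hf
  have hau := hr _ _ h1
  have hbu := hr _ _ h2
  have hiu := hi u
  refine ⟨fun x => if x = a then u else if x = u then a else if x = b then f u
    else if x = f u then b else f x, ⟨?_, ?_⟩, ?_⟩
  · intro x
    have := hi x
    grind
  · intro x
    have := hm x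
    have := hm u
    have := hm (f u)
    grind
  · have : msup (fun x => if x = a then u else if x = u then a else if x = b then f u
      else if x = f u then b else f x) = insert a (insert b (msup f)) := by
      ext x; simp only [mem_insert, mem_msup]; grind
    rw [this, card_insert_of_notMem, card_insert_of_notMem]
    · simp [mem_msup, fb]
    · simp [mem_msup, fa, hab]

def dg (r : V → V → Prop) [DecidableRel r] (W : Finset V) (v : V) : ℕ :=
  (W.filter (fun w => r v w)).card

theorem dg_erase (r : V → V → Prop) [DecidableRel r] (hr : ∀ x y, r x y → r y x)
    (hir : ∀ x, ¬ r x x) (W : Finset V) (v : V) (hv : v ∈ W) :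
    ∑ x ∈ W, dg r W x = ∑ x ∈ W.erase v, dg r (W.erase v) x + 2 * dg r W v := by
  have h1 : ∀ x ∈ W, dg r W x = dg r (W.erase v) x + if r v x then 1 else 0 := by
    intro x _
    unfold dg
    rw [Finset.filter_erase]
    by_cases h : r v x
    · have : v ∈ W.filter (fun w => r x w) := by simp [hv, hr _ _ h]
      rw [Finset.card_erase_of_mem this]
      have := Finset.card_pos.2 ⟨v, this⟩
      simp [h]; omega
    · rw [Finset.erase_eq_of_notMem]
      · simp [h]
      · simp; intro _ h'; exact h (hr _ _ h')
  rw [Finset.sum_congr rfl h1, Finset.sum_add_distrib, ← Finset.card_filter,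
    ← Finset.sum_erase_add _ _ hv]
  have h2 : dg r (W.erase v) v = dg r W v := by
    have := h1 v hv
    simp [hir] at this
    exact this.symm
  rw [h2]; unfold dg; ring

theorem erdos_gallai (r : V → V → Prop) [DecidableRel r] (hr : ∀ x y, r x y → r y x)
    (hir : ∀ x, ¬ r x x) (s : ℕ) : ∀ (W : Finset V), 4 * s ≤ W.card →
    (∀ f, PMt r W f → (msup f).card ≤ 2 * s) →
    ∑ x ∈ W, dg r W x + s ^ 2 + s ≤ 2 * s * W.card := by
  induction s with
  | zero =>
    intro W _ hM
    have : ∀ x ∈ W, dg r W x = 0 := by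
      intro x hx
      unfold dg
      rw [Finset.card_eq_zero, Finset.filter_eq_empty_iff]
      intro y hy hxy
      have hne : x ≠ y := by rintro rfl; exact hir _ hxy
      obtain ⟨g, hg, hc, _⟩ := add_edge hr (f := fun x => x) (W := W)
        ⟨fun _ => rfl, fun x hx => absurd rfl hx⟩ hx hy hne hxy rfl rfl
      have := hM g hg
      omega
    rw [Finset.sum_eq_zero this]; simp
  | succ s ih =>
    intro W hW hM
    by_cases hbig : ∃ v ∈ W, 2 * (s + 1) + 1 ≤ dg r W v
    · obtain ⟨v, hv, hd⟩ := hbig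
      have hc : (W.erase v).card = W.card - 1 := Finset.card_erase_of_mem hv
      have := ih (W.erase v) (by omega) ?_
      · rw [dg_erase r hr hir W v hv]
        have hdv : dg r W v ≤ W.card - 1 := by
          rw [← hc]
          apply Finset.card_le_card
          intro x hx
          simp at hx ⊢
          refine ⟨?_, hx.1⟩
          rintro rfl
          exact hir _ hx.2
        rw [hc] at this
        obtain ⟨N, hN⟩ : ∃ N, W.card = N + 1 := ⟨W.card - 1, by omega⟩
        rw [hN] at this hdv ⊢
        simp at this hdv
        nlinarith
      · intro f hf
        have hfW : PMt r W f := ⟨hf.1, fun x hx => ⟨Finset.mem_of_mem_erase (hf.2 x hx).1, (hf.2 x hx).2⟩⟩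
        have hle := hM f hfW
        have : ∃ w ∈ W.filter (fun w => r v w), w ∉ msup f := by
          apply Finset.exists_mem_notMem_of_card_lt_card
          unfold dg at hd
          omega
        obtain ⟨w, hw, hws⟩ := this
        simp at hw
        have fv : f v = v := by
          by_contra h
          have := (hf.2 v h).1
          simp at this
        have fw : f w = w := by simpa [mem_msup] using hws
        have hne : v ≠ w := by rintro rfl; exact hir _ hw.2
        obtain ⟨g, hg, hc, _⟩ := add_edge hr hfW hv hw.1 hne hw.2 fv fw
        have := hM g hg
        omega
    · push Not at hbig
      obtain ⟨f, hf, hmax⟩ : ∃ f, PMt r W f ∧ ∀ g, PMt r W g → (msup g).card ≤ (msup f).card := by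
        classical
        have := Finset.exists_max_image (univ.filter (fun f : V → V => PMt r W f))
          (fun f => (msup f).card) ⟨fun x => x, by
            rw [mem_filter]; exact ⟨mem_univ _, fun _ => rfl, fun x h => absurd rfl h⟩⟩
        obtain ⟨f, h1, h2⟩ := this
        exact ⟨f, by simpa using h1, fun g hg => h2 g (by simpa using hg)⟩
      have hSW : msup f ⊆ W := by
        intro x hx
        exact (hf.2 x ((mem_msup f x).1 hx)).1
      have hScard := hM f hf
      set U := W \ msup f with hU
      have hUf : ∀ x, x ∈ U → x ∈ W ∧ f x = x := by
        intro x hx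
        simp [hU, mem_msup] at hx
        exact hx
      have hind : ∀ x ∈ U, dg r W x = dg r (msup f) x := by
        intro x hx
        unfold dg
        congr 1
        ext y
        simp only [mem_filter]
        constructor
        · rintro ⟨hy, hxy⟩
          refine ⟨?_, hxy⟩
          by_contra hys
          have hne : x ≠ y := by rintro rfl; exact hir _ hxy
          obtain ⟨g, hg, hc, _⟩ := add_edge hr hf (hUf x hx).1 hy hne hxy (hUf x hx).2
            (by simpa [mem_msup] using hys)
          have := hmax g hg
          omega
        · rintro ⟨hy, hxy⟩
          exact ⟨hSW hy, hxy⟩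
      have hdc : ∑ x ∈ U, dg r (msup f) x = ∑ x ∈ msup f, dg r U x := by
        unfold dg
        simp only [Finset.card_filter]
        rw [Finset.sum_comm]
        apply Finset.sum_congr rfl; intro x _
        apply Finset.sum_congr rfl; intro y _
        have : r y x ↔ r x y := ⟨hr _ _, hr _ _⟩
        simp [this]
      have hpair : ∀ x ∈ msup f, dg r U x + dg r U (f x) ≤ 2 * (s + 1) := by
        intro u hu
        have hu' := (mem_msup f u).1 hu
        have hle : ∀ x ∈ W, dg r U x ≤ 2 * (s + 1) := by
          intro x hx
          have h1 := hbig x hx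
          have h2 : dg r U x ≤ dg r W x :=
            Finset.card_le_card (Finset.filter_subset_filter _ Finset.sdiff_subset)
          omega
        have hfu : f u ∈ msup f := by
          rw [mem_msup, hf.1]; exact hu'.symm
        have hno : ∀ a ∈ U, ∀ b ∈ U, r u a → r (f u) b → a = b := by
          intro a ha b hb h1 h2
          by_contra hab
          obtain ⟨g, hg, hc⟩ := augment hr hf (hUf a ha).1 (hUf b hb).1 hab (hUf a ha).2
            (hUf b hb).2 hu' h1 h2
          have := hmax g hg
          omega
        by_cases e1 : dg r U u = 0
        · rw [e1]; have := hle _ (hSW hfu); omega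
        by_cases e2 : dg r U (f u) = 0
        · rw [e2]; have := hle _ (hSW hu); omega
        obtain ⟨a, ha⟩ := Finset.card_pos.1 (Nat.pos_of_ne_zero e1)
        obtain ⟨b, hb⟩ := Finset.card_pos.1 (Nat.pos_of_ne_zero e2)
        simp at ha hb
        have c1 : dg r U u ≤ 1 := by
          apply Finset.card_le_one.2
          intro x hx y hy
          simp at hx hy
          rw [hno x hx.1 b hb.1 hx.2 hb.2, hno y hy.1 b hb.1 hy.2 hb.2]
        have c2 : dg r U (f u) ≤ 1 := by
          apply Finset.card_le_one.2
          intro x hx y hy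
          simp at hx hy
          rw [← hno a ha.1 x hx.1 ha.2 hx.2, ← hno a ha.1 y hy.1 ha.2 hy.2]
        omega
      have hinv : ∑ x ∈ msup f, dg r U (f x) = ∑ x ∈ msup f, dg r U x := by
        have hmem : ∀ x ∈ msup f, f x ∈ msup f := by
          intro x hx
          rw [mem_msup] at hx ⊢
          rw [hf.1]; exact hx.symm
        exact Finset.sum_nbij' f f hmem hmem (fun x _ => hf.1 x) (fun x _ => hf.1 x) (fun x _ => rfl)
      have hsU : 2 * ∑ x ∈ msup f, dg r U x ≤ (msup f).card * (2 * (s + 1)) := by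
        have := Finset.sum_le_sum hpair
        rw [Finset.sum_add_distrib, hinv, Finset.sum_const, smul_eq_mul] at this
        omega
      have hsS : ∑ x ∈ msup f, dg r W x ≤ (msup f).card * (2 * (s + 1)) := by
        have : ∑ x ∈ msup f, dg r W x ≤ ∑ x ∈ msup f, (2 * (s + 1)) :=
          Finset.sum_le_sum (fun x hx => by have := hbig x (hSW hx); omega)
        rwa [Finset.sum_const, smul_eq_mul] at this
      have hsplit : ∑ x ∈ W, dg r W x = ∑ x ∈ U, dg r W x + ∑ x ∈ msup f, dg r W x :=
        (Finset.sum_sdiff hSW).symm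
      rw [hsplit, Finset.sum_congr rfl hind, hdc]
      have hm : (msup f).card * (2 * (s + 1)) ≤ 2 * (s + 1) * (2 * (s + 1)) :=
        Nat.mul_le_mul_right _ hScard
      have hWm : 2 * (s + 1) * (4 * (s + 1)) ≤ 2 * (s + 1) * W.card := Nat.mul_le_mul_left _ hW
      nlinarith

/-- fixed-point-free involutions -/
def Perf (f : V → V) : Prop := (∀ x, f (f x) = x) ∧ ∀ x, f x ≠ x

def Fs (τ : V → V → ℤ) (f : V → V) : ℤ := ∑ x, τ x (f x)

theorem extend {r : V → V → Prop} {f : V → V} (hf : PMt r univ f) (hV : Even (Fintype.card V)) :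
    ∃ g, Perf g ∧ ∀ x, f x ≠ x → g x = f x := by
  classical
  obtain ⟨g, hg, hmax⟩ : ∃ g, (PMt (fun x y => x ≠ y) univ g ∧ ∀ x, f x ≠ x → g x = f x) ∧
      ∀ g', (PMt (fun x y => x ≠ y) univ g' ∧ ∀ x, f x ≠ x → g' x = f x) →
        (msup g').card ≤ (msup g).card := by
    have := Finset.exists_max_image (univ.filter (fun g : V → V =>
      PMt (fun x y => x ≠ y) univ g ∧ ∀ x, f x ≠ x → g x = f x))
      (fun f => (msup f).card) ⟨f, by
        rw [mem_filter]
        refine ⟨mem_univ _, ?_⟩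
        exact ⟨⟨hf.1, fun x hx => ⟨mem_univ _, hx.symm⟩⟩, fun _ _ => rfl⟩⟩
    obtain ⟨f, h1, h2⟩ := this
    exact ⟨f, by simpa using h1, fun g hg => h2 g (by simpa using hg)⟩
  obtain ⟨hg, hgf⟩ := hg
  refine ⟨g, ⟨hg.1, ?_⟩, hgf⟩
  intro x hx
  have huniq : ∀ y, g y = y → y = x := by
    intro y hy
    by_contra hne
    obtain ⟨g', h1, h2, h3⟩ := add_edge (r := fun x y : V => x ≠ y) (fun _ _ h => h.symm) hg
      (mem_univ y) (mem_univ x) hne hne hy hx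
    have := hmax g' ⟨h1, by
      intro z hz
      rw [h3 z (by rw [hgf z hz]; exact hz), hgf z hz]⟩
    omega
  have hs : msup g = univ.erase x := by
    ext y
    simp only [mem_msup, mem_erase, mem_univ, and_true]
    constructor
    · rintro h rfl; exact h hx
    · intro h h'; exact h (huniq y h')
  have hpar : ((msup g).card : ZMod 2) = 0 := by
    have : ∑ y ∈ msup g, (1 : ZMod 2) = 0 := by
      refine Finset.sum_involution (fun y _ => g y) ?_ ?_ ?_ ?_
      · intros; decide
      · intro y hy _; exact (mem_msup g y).1 hy
      · intro y hy
        rw [mem_msup] at hy ⊢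
        rw [hg.1]; exact hy.symm
      · intro y _; exact hg.1 y
    simpa using this
  rw [ZMod.natCast_eq_zero_iff] at hpar
  rw [hs, Finset.card_erase_of_mem (mem_univ _), Finset.card_univ] at hpar
  have : 0 < Fintype.card V := Fintype.card_pos_iff.2 ⟨x⟩
  obtain ⟨c, hc⟩ := hV
  omega

theorem connect (τ : V → V → ℤ) (hsym : ∀ x y, τ x y = τ y x)
    (hτ : ∀ x y, x ≠ y → τ x y = 1 ∨ τ x y = -1) (K : ℤ) (hK : 8 ≤ K)
    (hno : ∀ f, Perf f → K ≤ |Fs τ f|) (g : V → V) (hg : Perf g) (hpos : 0 < Fs τ g) (d : ℕ) :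
    ∀ f, Perf f → (univ.filter (fun x => f x ≠ g x)).card ≤ d → 0 < Fs τ f := by
  induction d with
  | zero =>
    intro f hf hd
    have : f = g := by
      funext x
      by_contra h
      have : x ∈ univ.filter (fun x => f x ≠ g x) := by simp [h]
      have := Finset.card_pos.2 ⟨x, this⟩
      omega
    rw [this]; exact hpos
  | succ d ih =>
    intro f hf hd
    by_cases hfg : f = g
    · rw [hfg]; exact hpos
    obtain ⟨v, hv⟩ : ∃ v, f v ≠ g v := by
      by_contra h
      push Not at h
      exact hfg (funext h)
    obtain ⟨f1, f2⟩ := hf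
    obtain ⟨g1, g2⟩ := hg
    set t := Equiv.swap (f v) (g v) with ht
    have htt : ∀ x, t (t x) = x := fun x => Equiv.swap_apply_self _ _ x
    have htx : ∀ x, t x = if x = f v then g v else if x = g v then f v else x :=
      fun x => Equiv.swap_apply_def _ _ x
    have hf' : Perf (fun x => t (f (t x))) := by
      constructor
      · intro x; simp [htt, f1]
      · intro x h
        have : f (t x) = t x := by
          have := congrArg t h
          rwa [htt] at this
        exact f2 _ this
    have hlt := ih (fun x => t (f (t x))) hf' (by
      have : (univ.filter (fun x => t (f (t x)) ≠ g x)) ⊂ (univ.filter (fun x => f x ≠ g x)) := by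
        rw [Finset.ssubset_iff_of_subset]
        · refine ⟨v, by simpa using hv, ?_⟩
          have a1 := f2 v
          have a2 := g2 v
          simp only [mem_filter, mem_univ, true_and, not_not, htx]
          grind
        · intro x
          simp only [mem_filter, mem_univ, true_and, htx]
          have b1 := f1 v
          have b2 := g1 v
          have b3 := f1 x
          have b4 := g1 x
          have b5 := f1 (g v)
          have b6 := f2 v
          have b7 := g2 v
          grind
      have := Finset.card_lt_card this
      omega)
    have hF' : Fs τ (fun x => t (f (t x))) = ∑ x, τ (t x) (t (f x)) := by
      unfold Fs
      rw [← Equiv.sum_comp t]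
      simp [htt]
    have hdiff : |Fs τ (fun x => t (f (t x))) - Fs τ f| ≤ 8 := by
      rw [hF']
      unfold Fs
      rw [← Finset.sum_sub_distrib]
      refine (Finset.abs_sum_le_sum_abs _ _).trans ?_
      have hb : ∀ x, |τ (t x) (t (f x)) - τ x (f x)| ≤
          if x ∈ ({f v, g v, v, f (g v)} : Finset V) then 2 else 0 := by
        intro x
        split_ifs with h
        · have h1 := hτ x (f x) (f2 x).symm
          have h2 := hτ (t x) (t (f x)) (fun h => f2 x (t.injective h).symm)
          rcases h1 with h1 | h1 <;> rcases h2 with h2 | h2 <;> rw [h1, h2] <;> norm_num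
        · have e1 : t x = x := by
            rw [htx]; simp at h; grind
          have e2 : t (f x) = f x := by
            rw [htx]; simp at h
            have := f1 x
            grind
          rw [e1, e2]; simp
      refine (Finset.sum_le_sum (fun x _ => hb x)).trans ?_
      rw [← Finset.sum_filter, Finset.sum_const]
      have : (univ.filter (fun x => x ∈ ({f v, g v, v, f (g v)} : Finset V))).card ≤ 4 := by
        rw [Finset.filter_univ_mem]; exact Finset.card_le_four
      simp only [nsmul_eq_mul]
      have : ((univ.filter (fun x => x ∈ ({f v, g v, v, f (g v)} : Finset V))).card : ℤ) ≤ 4 := by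
        exact_mod_cast this
      linarith
    have h1 := hno _ hf'
    have h2 := hno f ⟨f1, f2⟩
    rw [abs_of_pos hlt] at h1
    by_contra hneg
    rw [abs_of_nonpos (by linarith)] at h2
    have := (abs_le.1 hdiff).2
    linarith

theorem bound (τ : V → V → ℤ) (hsym : ∀ x y, τ x y = τ y x)
    (hτ : ∀ x y, x ≠ y → τ x y = 1 ∨ τ x y = -1) (n k : ℕ) (hk : 2 ≤ k)
    (hV : Fintype.card V = 4 * n)
    (hall : ∀ f : V → V, Perf f → 4 * (k : ℤ) ≤ Fs τ f) :
    2 * ((n : ℤ)*((n : ℤ) - 1) + (k : ℤ)*(6*(n : ℤ) - 1) + (k : ℤ)^2) ≤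
      ∑ x, ∑ y, if x ≠ y then τ x y else 0 := by
  classical
  set r : V → V → Prop := fun x y => x ≠ y ∧ τ x y = -1 with hrdef
  have hr : ∀ x y, r x y → r y x := fun x y h => ⟨h.1.symm, by rw [hsym]; exact h.2⟩
  have hir : ∀ x, ¬ r x x := fun x h => h.1 rfl
  have hev : Even (Fintype.card V) := ⟨2 * n, by omega⟩
  have hbd : ∀ f, PMt r univ f → 2 * (k : ℤ) + (msup f).card ≤ 2 * n := by
    intro f hf
    obtain ⟨g, hg, hgf⟩ := extend hf hev
    have h1 := hall g hg
    have h2 : Fs τ g ≤ ∑ x : V, (1 - if x ∈ msup f then 2 else 0) := by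
      apply Finset.sum_le_sum
      intro x _
      by_cases hx : x ∈ msup f
      · have hx' := (mem_msup f x).1 hx
        rw [hgf x hx', (hf.2 x hx').2.2]; simp [hx]
      · simp only [hx, if_false]
        rcases hτ x (g x) (hg.2 x).symm with h | h <;> rw [h] <;> norm_num
    rw [Finset.sum_sub_distrib, ← Finset.sum_filter, Finset.filter_univ_mem] at h2
    simp [hV] at h2
    linarith
  have hid : PMt r univ (fun x => x) := ⟨fun _ => rfl, fun x h => absurd rfl h⟩
  have hkn : k ≤ n := by
    have := hbd _ hid
    omega
  obtain ⟨s, rfl⟩ : ∃ s, n = s + k := ⟨n - k, by omega⟩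
  have heg := erdos_gallai r hr hir s univ (by rw [Finset.card_univ, hV]; omega) (by
    intro f hf
    have := hbd f hf
    push_cast at this
    omega)
  rw [Finset.card_univ, hV] at heg
  have hrow : ∀ x : V, (∑ y, if x ≠ y then τ x y else 0) = 4 * ((s + k : ℕ) : ℤ) - 1 - 2 * (dg r univ x : ℤ) := by
    intro x
    have : ∀ y, (if x ≠ y then τ x y else 0) =
        (1 : ℤ) - (if y = x then 1 else 0) - 2 * (if r x y then 1 else 0) := by
      intro y
      by_cases hxy : x = y
      · subst hxy; simp [hir]
      · have hyx : ¬ y = x := fun h => hxy h.symm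
        rcases hτ x y hxy with h | h <;> simp [hrdef, hxy, hyx, h]
    rw [Finset.sum_congr rfl (fun y _ => this y), Finset.sum_sub_distrib, Finset.sum_sub_distrib,
      ← Finset.mul_sum]
    rw [← Finset.sum_filter (fun y => r x y)]
    simp [dg, hV]
  rw [Finset.sum_congr rfl (fun x _ => hrow x), Finset.sum_sub_distrib, ← Finset.mul_sum]
  have heg' : (∑ x : V, (dg r univ x : ℤ)) + s ^ 2 + s ≤ 2 * s * (4 * (s + k)) := by
    exact_mod_cast heg
  simp only [Finset.sum_const, Finset.card_univ, hV, nsmul_eq_mul]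
  push_cast
  nlinarith

end aux

theorem stmt11 (n k : ℕ) (hn : 0 < n) (hk : 2 ≤ k) (σ : Sym2 (Fin (4*n)) → ℤ)
    (hσ : ∀ e ∈ (Kc (4*n)).edgeSet, σ e = 1 ∨ σ e = -1)
    (hsum : |sumE σ (Kc (4*n)).edgeSet| <
      (n : ℤ)*((n : ℤ) - 1) + (k : ℤ)*(6*(n : ℤ) - 1) + (k : ℤ)^2) :
    ∃ M : (Kc (4*n)).Subgraph, M.IsPerfectMatching ∧
      |sumE σ M.edgeSet| ≤ 2*(k : ℤ) - 2 := by
  classical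
  by_contra hcon
  push Not at hcon
  set τ : Fin (4*n) → Fin (4*n) → ℤ := fun x y => σ s(x, y) with hτdef
  have hsym : ∀ x y, τ x y = τ y x := fun x y => by simp only [hτdef, Sym2.eq_swap]
  have hτ : ∀ x y, x ≠ y → τ x y = 1 ∨ τ x y = -1 := fun x y h =>
    hσ _ (by simpa [Kc] using h)
  have hno : ∀ f, Perf f → 4 * (k : ℤ) ≤ |Fs τ f| := by
    intro f hf
    let M : (Kc (4*n)).Subgraph :=
      { verts := Set.univ
        Adj := fun x y => f x = y
        adj_sub := by
          rintro x y rfl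
          exact (hf.2 x).symm
        edge_vert := fun _ => Set.mem_univ _
        symm := ⟨by rintro x y rfl; exact hf.1 x⟩ }
    have hM : M.IsPerfectMatching := by
      rw [SimpleGraph.Subgraph.isPerfectMatching_iff]
      intro v
      exact ⟨f v, rfl, fun y hy => Eq.symm hy⟩
    have h1 := hcon M hM
    have h2 := two_sumE σ M.spanningCoe
    rw [SimpleGraph.Subgraph.edgeSet_spanningCoe] at h2
    have h3 : (∑ v, ∑ w, if M.spanningCoe.Adj v w then σ s(v, w) else 0) = Fs τ f := by
      apply Finset.sum_congr rfl
      intro x _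
      have : ∀ y, M.spanningCoe.Adj x y ↔ f x = y := fun y => Iff.rfl
      simp only [this, Finset.sum_ite_eq, mem_univ, if_true, hτdef]
    rw [h3] at h2
    have hpar : (2 : ℤ) ∣ sumE σ M.edgeSet := by
      have g1 := two_sumE (fun _ => 1) M.spanningCoe
      rw [SimpleGraph.Subgraph.edgeSet_spanningCoe] at g1
      have g2 : (∑ v, ∑ w, if M.spanningCoe.Adj v w then (1 : ℤ) else 0) = 4 * n := by
        have : ∀ x y, M.spanningCoe.Adj x y ↔ f x = y := fun x y => Iff.rfl
        simp only [this, Finset.sum_ite_eq, mem_univ, if_true]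
        simp
      rw [g2] at g1
      have g3 : (2 : ℤ) ∣ sumE σ M.edgeSet - sumE (fun _ => 1) M.edgeSet := by
        unfold sumE
        rw [← Finset.sum_sub_distrib]
        apply Finset.dvd_sum
        intro e he
        have := hσ e (M.edgeSet_subset (by simpa using he))
        rcases this with h | h <;> rw [h] <;> norm_num
      omega
    rw [← h2, abs_mul]
    obtain ⟨c, hc⟩ := hpar
    rw [hc, abs_mul] at h1 ⊢
    norm_num at h1 ⊢
    omega
  have hE := two_sumE σ (Kc (4*n))
  have hE' : (∑ v, ∑ w, if (Kc (4*n)).Adj v w then σ s(v, w) else 0) =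
      ∑ x, ∑ y, if x ≠ y then τ x y else 0 := by
    simp [Kc, hτdef]
  rw [hE'] at hE
  obtain ⟨hs1, hs2⟩ := abs_lt.1 hsum
  have hcase : (∀ f, Perf f → 4 * (k : ℤ) ≤ Fs τ f) ∨
      (∀ f, Perf f → 4 * (k : ℤ) ≤ Fs (fun x y => - τ x y) f) := by
    by_cases hex : ∃ g, Perf g ∧ 0 < Fs τ g
    · left
      obtain ⟨g, hg, hp⟩ := hex
      intro f hf
      have := connect τ hsym hτ (4 * k) (by omega) hno g hg hp _ f hf le_rfl
      have h2 := hno f hf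
      rwa [abs_of_pos this] at h2
    · right
      push Not at hex
      intro f hf
      have h2 := hno f hf
      rw [abs_of_nonpos (hex f hf)] at h2
      simpa [Fs] using h2
  rcases hcase with h | h
  · have := bound τ hsym hτ n k hk (by simp) h
    linarith
  · have := bound (fun x y => - τ x y) (fun x y => by simp [hsym x y])
      (fun x y hxy => by rcases hτ x y hxy with h | h <;> simp [h]) n k hk (by simp) h
    have e : (∑ x, ∑ y, if x ≠ y then - τ x y else 0) = - ∑ x, ∑ y, if x ≠ y then τ x y else 0 := by
      rw [← Finset.sum_neg_distrib]
      apply Finset.sum_congr rfl; intro x _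
      rw [← Finset.sum_neg_distrib]
      apply Finset.sum_congr rfl; intro y _
      split_ifs <;> simp
    rw [e] at this
    linarith
end

section
/- Let σ: E(K_{4n}) → {-1,1} with σ(E(K_{4n})) ≥ 0, and suppose every perfect matching M satisfies |σ(M)| ≥ 2k for some k ≥ 2. Then there is no perfect matching M with σ(M) ≤ 0; i.e., σ(M) > 0 for every perfect matching M. -/
open Finset

lemma dsum_aux {m : ℕ} (σ : Sym2 (Fin m) → ℤ) (S : Finset (Sym2 (Fin m)))
    (hS : ∀ e ∈ S, ¬ e.IsDiag) :
    ∑ q : Fin m × Fin m, (if s(q.1, q.2) ∈ S then σ s(q.1, q.2) else 0) = 2 * ∑ e ∈ S, σ e := by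
  classical
  rw [← Finset.sum_filter]
  rw [← Finset.sum_fiberwise_of_maps_to (s := Finset.univ.filter
    (fun q : Fin m × Fin m => s(q.1, q.2) ∈ S)) (t := S) (g := fun q => s(q.1, q.2))
    (by intro q hq; simpa using hq), Finset.mul_sum]
  refine Finset.sum_congr rfl fun e he => ?_
  induction e using Sym2.ind with
  | _ a b =>
    have hab : a ≠ b := by simpa using hS _ he
    have : (Finset.univ.filter (fun q : Fin m × Fin m => s(q.1, q.2) ∈ S)).filter
        (fun q => s(q.1, q.2) = s(a, b)) = {(a, b), (b, a)} := by
      ext ⟨x, y⟩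
      simp only [Finset.mem_filter, Finset.mem_univ, true_and, Finset.mem_insert,
        Finset.mem_singleton, Prod.mk.injEq]
      constructor
      · rintro ⟨-, h⟩; simpa using h
      · intro h
        have h2 : s(x, y) = s(a, b) := by simpa using h
        exact ⟨h2 ▸ he, h2⟩
    rw [this, Finset.sum_pair (by simp [hab])]
    simp only [Sym2.eq_swap (a := b) (b := a)]
    ring

lemma key_perm {m : ℕ} (τ : Fin m → Fin m → ℤ) (hsym : ∀ v w, τ v w = τ w v)
    (hb : ∀ v w, v ≠ w → |τ v w| ≤ 1) (hm : 2 ≤ m)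
    (hT : 0 ≤ ∑ v, ∑ w, if v = w then 0 else τ v w)
    (hbig : ∀ p : Equiv.Perm (Fin m), (∀ v, p v ≠ v) → (∀ v, p (p v) = v) →
      8 ≤ |∑ v, τ v (p v)|)
    (p : Equiv.Perm (Fin m)) (h1 : ∀ v, p v ≠ v) (h2 : ∀ v, p (p v) = v) :
    0 < ∑ v, τ v (p v) := by
  classical
  by_contra hneg
  push Not at hneg
  obtain ⟨p, hp, hmax⟩ := Finset.exists_max_image
    (Finset.univ.filter (fun p : Equiv.Perm (Fin m) => (∀ v, p v ≠ v) ∧ (∀ v, p (p v) = v) ∧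
      ∑ v, τ v (p v) ≤ 0)) (fun p => ∑ v, τ v (p v)) ⟨p, by simp [h1, h2, hneg]⟩
  simp only [Finset.mem_filter, Finset.mem_univ, true_and] at hp hmax
  obtain ⟨h1, h2, hneg⟩ := hp
  have hS : ∑ v, τ v (p v) ≤ -8 := by
    have := hbig p h1 h2
    rw [abs_of_nonpos hneg] at this
    linarith
  have hswap : ∀ v w, w ≠ v → w ≠ p v → τ v w + τ (p v) (p w) ≤ τ v (p v) + τ w (p w) := by
    intro v w hwv hwp
    set q : Equiv.Perm (Fin m) := Equiv.swap (p v) w * p * Equiv.swap (p v) w with hq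
    have q1 : ∀ x, q x ≠ x := by
      intro x hx
      apply h1 (Equiv.swap (p v) w x)
      have := congrArg (Equiv.swap (p v) w) hx
      simpa [hq] using this
    have q2 : ∀ x, q (q x) = x := by intro x; simp [hq, h2]
    have hvw : v ≠ p w := fun h => hwp (by rw [h, h2])
    have hpp : p v ≠ p w := fun h => hwv (p.injective h).symm
    have e1 : q v = w := by
      simp [hq, Equiv.swap_apply_of_ne_of_ne (h1 v).symm hwv.symm]
    have e2 : q w = v := by rw [← e1, q2]
    have e3 : q (p v) = p w := by
      simp [hq, Equiv.swap_apply_of_ne_of_ne hpp.symm (h1 w)]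
    have e4 : q (p w) = p v := by rw [← e3, q2]
    have e5 : ∀ x, x ≠ v → x ≠ w → x ≠ p v → x ≠ p w → q x = p x := by
      intro x a b c d
      have : p x ≠ p v := fun h => a (p.injective h)
      have : p x ≠ w := fun h => d (by rw [← h, h2])
      simp [hq, Equiv.swap_apply_of_ne_of_ne, *]
    have hdiff : ∑ x, τ x (q x) - ∑ x, τ x (p x) =
        2 * (τ v w + τ (p v) (p w) - τ v (p v) - τ w (p w)) := by
      rw [← Finset.sum_sub_distrib, ← Finset.sum_subset
        (Finset.subset_univ ({v, w, p v, p w} : Finset (Fin m)))]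
      · have := h1 v
        have := h1 w
        rw [Finset.sum_insert (by simp; tauto), Finset.sum_insert (by simp; tauto),
          Finset.sum_pair hpp, e1, e2, e3, e4, h2, h2, hsym w v, hsym (p w) (p v),
          hsym (p v) v, hsym (p w) w]
        ring
      · intro x _ hx
        simp only [Finset.mem_insert, Finset.mem_singleton, not_or] at hx
        rw [e5 x hx.1 hx.2.1 hx.2.2.1 hx.2.2.2, sub_self]
    have b1 := abs_le.1 (hb v w hwv.symm)
    have b2 := abs_le.1 (hb (p v) (p w) hpp)
    have b3 := abs_le.1 (hb v (p v) (h1 v).symm)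
    have b4 := abs_le.1 (hb w (p w) (h1 w).symm)
    have := hmax q ⟨q1, q2, by linarith⟩
    linarith
  -- summation
  set S := ∑ v, τ v (p v) with hSdef
  set T := ∑ v, ∑ w, (if v = w then 0 else τ v w) with hTdef
  have hsum : ∑ v, ∑ w, (if w = v ∨ w = p v then 0 else τ v w + τ (p v) (p w)) ≤
      ∑ v, ∑ w, (if w = v ∨ w = p v then 0 else τ v (p v) + τ w (p w)) := by
    refine Finset.sum_le_sum fun v _ => Finset.sum_le_sum fun w _ => ?_
    split_ifs with h
    · exact le_rfl
    · push Not at h; exact hswap v w h.1 h.2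
  have hT2 : ∑ v, ∑ w, (if p v = p w then 0 else τ (p v) (p w)) = T := by
    rw [hTdef, ← Equiv.sum_comp p]
    refine Finset.sum_congr rfl fun v _ => ?_
    rw [← Equiv.sum_comp p]
    simp only [h2]
  have hS2 : ∑ v, τ (p v) v = S := by
    rw [hSdef]; exact Finset.sum_congr rfl fun v _ => hsym _ _
  have hL : ∑ v, ∑ w, (if w = v ∨ w = p v then 0 else τ v w + τ (p v) (p w)) =
      2 * T - 2 * S := by
    have : ∀ v w, (if w = v ∨ w = p v then 0 else τ v w + τ (p v) (p w)) =
        (if v = w then 0 else τ v w) + (if p v = p w then 0 else τ (p v) (p w))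
         - (if w = p v then τ v (p v) + τ (p v) v else 0) := by
      intro v w
      by_cases a : w = v
      · subst a; simp [(h1 w).symm]
      · by_cases b : w = p v
        · subst b; simp [h2, h1, (h1 v).symm]
        · simp [a, b, Ne.symm a]
    simp only [this, Finset.sum_sub_distrib, Finset.sum_add_distrib, hT2,
      Finset.sum_ite_eq', Finset.mem_univ, if_true, hS2, Finset.sum_ite_eq]
    rw [← hSdef, ← hTdef]; ring
  have hR : ∑ v, ∑ w, (if w = v ∨ w = p v then 0 else τ v (p v) + τ w (p w)) =
      2 * m * S - 4 * S := by
    have : ∀ v w, (if w = v ∨ w = p v then 0 else τ v (p v) + τ w (p w)) =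
        τ v (p v) + τ w (p w) - (if w = v then τ v (p v) + τ v (p v) else 0)
         - (if w = p v then τ v (p v) + τ (p v) v else 0) := by
      intro v w
      by_cases a : w = v
      · subst a; simp [(h1 w).symm]
      · by_cases b : w = p v
        · subst b; simp [h2, h1]
        · simp [a, b]
    simp only [this, Finset.sum_sub_distrib, Finset.sum_add_distrib,
      Finset.sum_ite_eq', Finset.mem_univ, if_true, hS2, Finset.sum_const, Finset.card_univ,
      Fintype.card_fin, nsmul_eq_mul, ← Finset.mul_sum]
    rw [← hSdef]; ring
  rw [hL, hR] at hsum
  have : (2 : ℤ) ≤ m := by exact_mod_cast hm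
  nlinarith

lemma sumE_perm {m : ℕ} (σ : Sym2 (Fin m) → ℤ) (M : (Kc m).Subgraph) (p : Fin m → Fin m)
    (hp : ∀ v w, M.Adj v w ↔ p v = w) :
    ∑ v, σ s(v, p v) = 2 * sumE σ M.edgeSet := by
  classical
  unfold sumE
  rw [← dsum_aux, Fintype.sum_prod_type]
  · simp [hp]
  · intro e he
    simp only [Set.Finite.mem_toFinset] at he
    exact (Kc m).not_isDiag_of_mem_edgeSet (M.edgeSet_subset he)

theorem stmt18 (n k : ℕ) (hn : 0 < n) (hk : 2 ≤ k) (σ : Sym2 (Fin (4*n)) → ℤ)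
    (hσ : ∀ e ∈ (Kc (4*n)).edgeSet, σ e = 1 ∨ σ e = -1)
    (hsum : 0 ≤ sumE σ (Kc (4*n)).edgeSet)
    (hbig : ∀ M : (Kc (4*n)).Subgraph, M.IsPerfectMatching →
      2*(k : ℤ) ≤ |sumE σ M.edgeSet|) :
    ∀ M : (Kc (4*n)).Subgraph, M.IsPerfectMatching → 0 < sumE σ M.edgeSet := by
  classical
  intro M hM
  have hfun : ∀ v, ∃! w, M.Adj v w := SimpleGraph.Subgraph.isPerfectMatching_iff.1 hM
  choose f hf hfu using hfun
  have hf2 : ∀ v, f (f v) = v := fun v => (hfu (f v) v (hf v).symm).symm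
  have hadj : ∀ v w, M.Adj v w ↔ f v = w :=
    fun v w => ⟨fun h => (hfu v w h).symm, fun h => h ▸ hf v⟩
  have key := key_perm (fun v w => σ s(v, w)) (fun v w => by rw [Sym2.eq_swap])
    (fun v w h => by
      rcases hσ s(v, w) (by simpa [Kc] using h) with h | h <;> simp [h])
    (by omega) (by
      have := dsum_aux σ (Kc (4*n)).edgeSet.toFinite.toFinset (by
        intro e he
        simp only [Set.Finite.mem_toFinset] at he
        exact (Kc _).not_isDiag_of_mem_edgeSet he)
      rw [Fintype.sum_prod_type] at this
      have h3 : ∑ v, ∑ w, (if v = w then 0 else σ s(v, w)) =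
          2 * sumE σ (Kc (4*n)).edgeSet := by
        unfold sumE
        rw [← this]
        refine Finset.sum_congr rfl fun v _ => Finset.sum_congr rfl fun w _ => ?_
        simp [Kc]
      rw [h3]; linarith)
    (by
      intro p p1 p2
      let N : (Kc (4*n)).Subgraph :=
        { verts := Set.univ
          Adj := fun v w => p v = w
          adj_sub := by
            intro v w h
            subst h
            simpa [Kc] using (p1 v).symm
          edge_vert := by intros; trivial
          symm := ⟨by intro v w h; rw [← h, p2]⟩ }
      have hN : N.IsPerfectMatching := by
        rw [SimpleGraph.Subgraph.isPerfectMatching_iff]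
        intro v
        exact ⟨p v, rfl, fun y hy => Eq.symm hy⟩
      have h4 := hbig N hN
      rw [sumE_perm σ N p (fun _ _ => Iff.rfl), abs_mul, abs_two]
      have : (2 : ℤ) ≤ k := by exact_mod_cast hk
      linarith)
    ⟨f, f, hf2, hf2⟩ (fun v h => (hf v).ne h.symm) hf2
  have h5 := sumE_perm σ M f hadj
  simp only [Equiv.coe_fn_mk] at key
  linarith
end
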